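/- Let f : Mat(L×L, ℂ) → ℂ be continuous on the closed matrix unit disc { Z : 1 − Z^*Z is positive semidefinite } and analytic on the open matrix unit disc 𝔻_L = { Z : 1 − Z^*Z is positive definite }. Then for every Z ∈ 𝔻_L and every unitary U the matrix 1 − Z U^* is invertible, and f(Z) = ∫_{U(L)} det(1 − Z U^*)^{-L} · f(U) dU, where dU is the normalized Haar measure on the unitary group U(L). -/

import Mathlib

open MeasureTheory Matrix
open scoped ComplexOrder

noncomputable section

/-- The space of complex `L × L` matrices. -/
abbrev Mat (L : ℕ) := Matrix (Fin L) (Fin L) ℂ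

instance (L : ℕ) : MeasurableSpace (Matrix.unitaryGroup (Fin L) ℂ) := borel _

section LinearSubstitution

open MvPolynomial

variable {σ : Type*}

lemma homogeneousSubmodule_ext {k : ℕ} {p q : homogeneousSubmodule σ ℂ k}
    (h : ∀ x, eval x (p : MvPolynomial σ ℂ) = eval x (q : MvPolynomial σ ℂ)) : p = q :=
  Subtype.ext (MvPolynomial.funext h)

lemma linearIndependent_monomial (s : Set (σ →₀ ℕ)) :
    LinearIndependent ℂ fun d : s => monomial (d : σ →₀ ℕ) (1 : ℂ) := by
  have := (basisMonomials σ ℂ).linearIndependent.comp ((↑) : s → σ →₀ ℕ) Subtype.val_injective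
  simpa [Function.comp_def] using this

lemma span_range_monomial (k : ℕ) :
    Submodule.span ℂ (Set.range fun d : {d : σ →₀ ℕ | d.degree = k} =>
      monomial (d : σ →₀ ℕ) (1 : ℂ)) = homogeneousSubmodule σ ℂ k := by
  rw [homogeneousSubmodule_eq_finsupp_supported]
  refine Eq.trans ?_ (restrictSupport_eq_span ℂ _).symm
  rw [Set.image_eq_range]

/-- The monomial basis of the homogeneous polynomials of degree `k`. -/
def homogeneousBasis (σ : Type*) (k : ℕ) :
    Module.Basis {d : σ →₀ ℕ | d.degree = k} ℂ (homogeneousSubmodule σ ℂ k) :=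
  (Module.Basis.span (linearIndependent_monomial _)).map
    (LinearEquiv.ofEq _ _ (span_range_monomial k))

lemma homogeneousBasis_apply (k : ℕ) (d : {d : σ →₀ ℕ | d.degree = k}) :
    (homogeneousBasis σ k d : MvPolynomial σ ℂ) = monomial (d : σ →₀ ℕ) 1 := by
  rw [homogeneousBasis, Module.Basis.map_apply, LinearEquiv.coe_ofEq_apply,
    Module.Basis.span_apply]

variable [Fintype σ]

/-- The linear substitution `p(x) ↦ p(M x)` on polynomials. -/
def linSubst (M : Matrix σ σ ℂ) : MvPolynomial σ ℂ →ₐ[ℂ] MvPolynomial σ ℂ :=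
  aeval fun i => ∑ j, C (M i j) * X j

lemma eval_linSubst (M : Matrix σ σ ℂ) (x : σ → ℂ) (p : MvPolynomial σ ℂ) :
    eval x (linSubst M p) = eval (M *ᵥ x) p := by
  induction p using MvPolynomial.induction_on with
  | C a => simp [linSubst]
  | add p q hp hq => simp [hp, hq]
  | mul_X p i hp => simp [hp]; left; simp [linSubst, Matrix.mulVec, dotProduct]

lemma isHomogeneous_linSubst (M : Matrix σ σ ℂ) {k : ℕ} {p : MvPolynomial σ ℂ}
    (hp : p.IsHomogeneous k) : (linSubst M p).IsHomogeneous k := by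
  have := hp.aeval (n := 1) (fun i => ∑ j, C (M i j) * X j)
    (fun i => IsHomogeneous.sum _ _ _ fun j _ => isHomogeneous_C_mul_X _ _)
  simpa [linSubst] using this

/-- The linear substitution `p(x) ↦ p(M x)` on homogeneous polynomials of degree `k`. -/
def homSubst (k : ℕ) (M : Matrix σ σ ℂ) :
    homogeneousSubmodule σ ℂ k →ₗ[ℂ] homogeneousSubmodule σ ℂ k :=
  (linSubst M).toLinearMap.restrict fun _ hp => isHomogeneous_linSubst M hp

@[simp] lemma eval_homSubst (k : ℕ) (M : Matrix σ σ ℂ) (x : σ → ℂ)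
    (p : homogeneousSubmodule σ ℂ k) :
    eval x (homSubst k M p : MvPolynomial σ ℂ) = eval (M *ᵥ x) (p : MvPolynomial σ ℂ) :=
  eval_linSubst M x p

lemma homSubst_mul (k : ℕ) (A B : Matrix σ σ ℂ) :
    homSubst k (A * B) = homSubst k B * homSubst k A := by
  refine LinearMap.ext fun p => homogeneousSubmodule_ext fun x => ?_
  simp [Module.End.mul_apply, Matrix.mulVec_mulVec]

lemma homSubst_one [DecidableEq σ] (k : ℕ) : homSubst k (1 : Matrix σ σ ℂ) = 1 := by
  refine LinearMap.ext fun p => homogeneousSubmodule_ext fun x => ?_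
  simp

lemma trace_homSubst_diagonal [DecidableEq σ] (k : ℕ) (l : σ → ℂ) :
    LinearMap.trace ℂ _ (homSubst k (Matrix.diagonal l)) =
      PowerSeries.coeff k (∏ i, PowerSeries.mk fun n => l i ^ n) := by
  have hmem : ∀ d : σ →₀ ℕ, d ∈ Finset.finsuppAntidiag Finset.univ k ↔
      d ∈ {d : σ →₀ ℕ | d.degree = k} := fun d => by
    simp [Finsupp.degree_eq_sum]
  let : Fintype {d : σ →₀ ℕ | d.degree = k} := Fintype.ofFinset _ hmem
  have hb : ∀ d, homSubst k (Matrix.diagonal l) (homogeneousBasis σ k d) =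
      (∏ i, l i ^ d.1 i) • homogeneousBasis σ k d := fun d => by
    refine homogeneousSubmodule_ext fun x => ?_
    rw [eval_homSubst, Submodule.coe_smul, homogeneousBasis_apply, smul_eval, eval_monomial,
      eval_monomial, Finsupp.prod_fintype _ _ (by simp), Finsupp.prod_fintype _ _ (by simp)]
    simp only [Matrix.mulVec_diagonal, mul_pow, Finset.prod_mul_distrib, one_mul]
  rw [LinearMap.trace_eq_matrix_trace ℂ (homogeneousBasis σ k), PowerSeries.coeff_prod,
    Matrix.trace]
  simp only [Matrix.diag_apply, LinearMap.toMatrix_apply, hb, map_smul, Module.Basis.repr_self,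
    Finsupp.smul_apply, Finsupp.single_eq_same, smul_eq_mul, mul_one, PowerSeries.coeff_mk]
  exact (Finset.sum_subtype _ hmem fun d => ∏ i, l i ^ d i).symm

lemma charpolyRev_diagonal [DecidableEq σ] (l : σ → ℂ) :
    (Matrix.diagonal l).charpolyRev = ∏ i, (1 - Polynomial.C (l i) * Polynomial.X) := by
  rw [Matrix.charpolyRev, ← Matrix.det_diagonal]
  congr 1
  ext1 i j
  rcases eq_or_ne i j with rfl | h
  · simp only [Matrix.sub_apply, Matrix.one_apply_eq, Matrix.smul_apply, Matrix.map_apply,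
      Matrix.diagonal_apply_eq, smul_eq_mul, Polynomial.X_mul_C]
  · simp [h]

lemma charpolyRev_conj [DecidableEq σ] {P Q : Matrix σ σ ℂ} (M : Matrix σ σ ℂ) (h : Q * P = 1) :
    (P * M * Q).charpolyRev = M.charpolyRev := by
  rw [← Matrix.reverse_charpoly, ← Matrix.reverse_charpoly, Matrix.charpoly_mul_comm,
    ← Matrix.mul_assoc, h, Matrix.one_mul]

/-- Molien's formula for a diagonalizable matrix. -/
lemma mk_trace_homSubst_mul_charpolyRev [DecidableEq σ] {P Q : Matrix σ σ ℂ} (l : σ → ℂ)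
    (h : Q * P = 1) :
    (PowerSeries.mk fun k => LinearMap.trace ℂ _ (homSubst k (P * Matrix.diagonal l * Q))) *
      ((P * Matrix.diagonal l * Q).charpolyRev : PowerSeries ℂ) = 1 := by
  have h1 : (PowerSeries.mk fun k =>
      LinearMap.trace ℂ _ (homSubst k (P * Matrix.diagonal l * Q))) =
      ∏ i, PowerSeries.mk fun n => l i ^ n := by
    ext k
    rw [PowerSeries.coeff_mk, ← trace_homSubst_diagonal, homSubst_mul, homSubst_mul,
      LinearMap.trace_mul_comm, mul_assoc, ← homSubst_mul, h, homSubst_one, mul_one]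
  rw [h1, charpolyRev_conj _ h, charpolyRev_diagonal, ← Polynomial.coeToPowerSeries.ringHom_apply,
    map_prod, ← Finset.prod_mul_distrib]
  refine Finset.prod_eq_one fun i _ => ?_
  ext n
  cases n with
  | zero => simp [mul_sub]
  | succ n =>
    rw [map_sub, map_one, mul_sub, mul_one, map_mul Polynomial.coeToPowerSeries.ringHom,
      ← mul_assoc]
    simp [PowerSeries.coeff_succ_mul_X, pow_succ, PowerSeries.coeff_one]

end LinearSubstitution

section UnitaryDiagonalization

variable {σ : Type*} [Fintype σ] [DecidableEq σ]

/-- A matrix whose eigenvectors span is diagonalizable. -/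
lemma exists_diagonalization_of_span_eq_top {M : Matrix σ σ ℂ}
    (h : ⊤ ≤ Submodule.span ℂ {v : σ → ℂ | ∃ c : ℂ, M *ᵥ v = c • v}) :
    ∃ (P Q : Matrix σ σ ℂ) (l : σ → ℂ), Q * P = 1 ∧ M = P * Matrix.diagonal l * Q := by
  let b₀ := Module.Basis.ofSpan h
  have : Finite _ := Module.Finite.finite_basis b₀
  let := Fintype.ofFinite ↑((linearIndepOn_empty ℂ id).extend
    (Set.empty_subset {v : σ → ℂ | ∃ c : ℂ, M *ᵥ v = c • v}))
  let e := Fintype.equivOfCardEq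
    ((Module.finrank_eq_card_basis b₀).symm.trans (Module.finrank_fintype_fun_eq_card ℂ (η := σ)))
  let b : Module.Basis σ ℂ (σ → ℂ) := b₀.reindex e
  have hb : ∀ i, ∃ c : ℂ, M *ᵥ b i = c • b i := fun i => by
    have := Module.Basis.ofSpan_subset h (Set.mem_range_self (e.symm i))
    rw [Module.Basis.reindex_apply]
    exact this
  choose l hl using hb
  let P : Matrix σ σ ℂ := Matrix.of fun i j => b j i
  have hP : M * P = P * Matrix.diagonal l := by
    ext i j
    have := congrFun (hl j) i
    simp only [Matrix.mulVec, dotProduct, Pi.smul_apply, smul_eq_mul] at this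
    rw [Matrix.mul_diagonal, Matrix.mul_apply]
    simp only [P, Matrix.of_apply, this, mul_comm]
  have hunit : IsUnit P := by
    have := (Matrix.linearIndependent_cols_iff_isUnit (A := P)).1
    exact this b.linearIndependent
  have hdet : IsUnit P.det := (Matrix.isUnit_iff_isUnit_det P).1 hunit
  refine ⟨P, P⁻¹, l, Matrix.nonsing_inv_mul _ hdet, ?_⟩
  rw [← hP, Matrix.mul_assoc, Matrix.mul_nonsing_inv _ hdet, Matrix.mul_one]

lemma exists_diagonalization_of_mem_unitaryGroup {M : Matrix σ σ ℂ}
    (hM : M ∈ Matrix.unitaryGroup σ ℂ) :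
    ∃ (P Q : Matrix σ σ ℂ) (l : σ → ℂ), Q * P = 1 ∧ M = P * Matrix.diagonal l * Q := by
  apply exists_diagonalization_of_span_eq_top
  have h1 : M * Mᴴ = 1 := Matrix.mem_unitaryGroup_iff.1 hM
  have h2 : Mᴴ * M = 1 := Matrix.mem_unitaryGroup_iff'.1 hM
  let A := M + Mᴴ
  let B := Complex.I • (M - Mᴴ)
  have hA : A.IsHermitian := by
    simp [A, Matrix.IsHermitian, Matrix.conjTranspose_add, add_comm]
  have hB : B.IsHermitian := by
    simp [B, Matrix.IsHermitian, Matrix.conjTranspose_smul, ← smul_neg]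
  have hcomm : A * B = B * A := by
    simp [A, B, mul_add, add_mul, mul_sub, sub_mul, h1, h2, ← smul_add]
    abel_nf
  have key := LinearMap.IsSymmetric.iSup_iSup_eigenspace_inf_eigenspace_eq_top_of_commute
    (Matrix.isSymmetric_toEuclideanLin_iff.2 hA) (Matrix.isSymmetric_toEuclideanLin_iff.2 hB)
    (show toEuclideanLin A * toEuclideanLin B = toEuclideanLin B * toEuclideanLin A by
      rw [Module.End.mul_eq_comp, Module.End.mul_eq_comp, ← Matrix.toLpLin_mul_same,
        ← Matrix.toLpLin_mul_same, hcomm])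
  have hle : (⊤ : Submodule ℂ (EuclideanSpace ℂ σ)) ≤
      (Submodule.span ℂ {v : σ → ℂ | ∃ c : ℂ, M *ᵥ v = c • v}).comap
        (WithLp.linearEquiv 2 ℂ (σ → ℂ)).toLinearMap := by
    rw [← key]
    refine iSup_le fun α => iSup_le fun γ => fun v hv => ?_
    obtain ⟨hvA, hvB⟩ := Submodule.mem_inf.1 hv
    have eA : A *ᵥ v.ofLp = α • v.ofLp :=
      congrArg WithLp.ofLp (Module.End.mem_eigenspace_iff.1 hvA)
    have eB : B *ᵥ v.ofLp = γ • v.ofLp :=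
      congrArg WithLp.ofLp (Module.End.mem_eigenspace_iff.1 hvB)
    refine Submodule.subset_span ⟨(1 / 2 : ℂ) * (α - Complex.I * γ), ?_⟩
    have hM' : M = (1 / 2 : ℂ) • (A - Complex.I • B) := by
      simp only [A, B, smul_smul, Complex.I_mul_I]
      module
    change M *ᵥ v.ofLp = _ • v.ofLp
    rw [hM', Matrix.smul_mulVec, Matrix.sub_mulVec, Matrix.smul_mulVec, eA, eB]
    module
  intro v _
  exact hle (x := WithLp.toLp 2 v) trivial

end UnitaryDiagonalization

section SzegoCoefficients

open MvPolynomial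
open scoped Kronecker

variable {L : ℕ}

/-- The entries of a matrix, as a family indexed by pairs. -/
def entries (A : Mat L) : Fin L × Fin L → ℂ := fun p => A p.1 p.2

lemma kronecker_one_mulVec_entries (A X : Mat L) :
    (A ⊗ₖ (1 : Mat L)) *ᵥ entries X = entries (A * X) := by
  ext ⟨i, j⟩
  simp [Matrix.mulVec, dotProduct, Fintype.sum_prod_type, entries, Matrix.mul_apply,
    Matrix.kroneckerMap_apply, Matrix.one_apply]

lemma one_kronecker_transpose_mulVec_entries (B X : Mat L) :
    ((1 : Mat L) ⊗ₖ Bᵀ) *ᵥ entries X = entries (X * B) := by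
  ext ⟨i, j⟩
  simp [Matrix.mulVec, dotProduct, Fintype.sum_prod_type, entries, Matrix.mul_apply,
    Matrix.kroneckerMap_apply, Matrix.one_apply, mul_comm]

lemma charpolyRev_map {R S : Type*} [CommRing R] [CommRing S] {n : Type*} [Fintype n]
    [DecidableEq n] (f : R →+* S) (M : Matrix n n R) :
    (M.map f).charpolyRev = M.charpolyRev.map f := by
  rw [Matrix.charpolyRev, Matrix.charpolyRev, ← Polynomial.coe_mapRingHom, RingHom.map_det]
  congr 1
  ext1 i j
  rcases eq_or_ne i j with rfl | h
  · simp
  · simp [h]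

lemma charpolyRev_kronecker_one (A : Mat L) :
    (A ⊗ₖ (1 : Mat L)).charpolyRev = A.charpolyRev ^ L := by
  have : (1 - (Polynomial.X : Polynomial ℂ) • (A ⊗ₖ (1 : Mat L)).map Polynomial.C) =
      (1 - (Polynomial.X : Polynomial ℂ) • A.map Polynomial.C) ⊗ₖ
        (1 : Matrix (Fin L) (Fin L) (Polynomial ℂ)) := by
    ext1 ⟨i, j⟩ ⟨k, l⟩
    rcases eq_or_ne j l with rfl | h
    · simp [Matrix.kroneckerMap_apply, Matrix.one_apply]
    · simp [Matrix.kroneckerMap_apply, h]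
  rw [Matrix.charpolyRev, this, Matrix.det_kronecker]
  simp [Matrix.charpolyRev]

/-- The coefficient of `t ^ k` in `det(1 - t A) ^ (-L)`, as a polynomial in the entries of `A`. -/
def szegoPoly (L k : ℕ) : MvPolynomial (Fin L × Fin L) ℂ :=
  PowerSeries.coeff k (PowerSeries.invOfUnit
    (((Matrix.mvPolynomialX (Fin L) (Fin L) ℂ).charpolyRev :
      PowerSeries (MvPolynomial (Fin L × Fin L) ℂ)) ^ L) 1)

/-- The formal power series expansion of `det(1 - t A) ^ (-L)`. -/
lemma mk_eval_szegoPoly_mul_charpolyRev (A : Mat L) :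
    (PowerSeries.mk fun k => eval (entries A) (szegoPoly L k)) *
      (A.charpolyRev : PowerSeries ℂ) ^ L = 1 := by
  have h := PowerSeries.mul_invOfUnit
    (((Matrix.mvPolynomialX (Fin L) (Fin L) ℂ).charpolyRev :
      PowerSeries (MvPolynomial (Fin L × Fin L) ℂ)) ^ L) 1 (by
        rw [map_pow, Polynomial.constantCoeff_coe, Polynomial.coeff_zero_eq_eval_zero,
          Matrix.eval_charpolyRev, one_pow, Units.val_one])
  have h' := congrArg (PowerSeries.map (eval (entries A))) h
  have hA : (Matrix.mvPolynomialX (Fin L) (Fin L) ℂ).map (eval (entries A)) = A := by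
    ext i j; simp [entries]
  rw [map_mul, map_pow, map_one, ← Polynomial.polynomial_map_coe, ← charpolyRev_map, hA] at h'
  rw [mul_comm, ← h']
  congr 1
  ext k
  simp [szegoPoly]

lemma eval_szegoPoly_eq_trace {A : Mat L} (hA : A ∈ Matrix.unitaryGroup (Fin L) ℂ) (k : ℕ) :
    eval (entries A) (szegoPoly L k) = LinearMap.trace ℂ _ (homSubst k (A ⊗ₖ (1 : Mat L))) := by
  obtain ⟨P, Q, l, hQP, hPQ⟩ := exists_diagonalization_of_mem_unitaryGroup hA
  have hker : A ⊗ₖ (1 : Mat L) =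
      (P ⊗ₖ (1 : Mat L)) * Matrix.diagonal (fun p : Fin L × Fin L => l p.1) *
        (Q ⊗ₖ (1 : Mat L)) := by
    have hd : Matrix.diagonal (fun p : Fin L × Fin L => l p.1) =
        Matrix.diagonal l ⊗ₖ (1 : Mat L) := by
      rw [← Matrix.diagonal_one, Matrix.diagonal_kronecker_diagonal]
      simp
    rw [hd, ← Matrix.mul_kronecker_mul, ← Matrix.mul_kronecker_mul, ← hPQ]
    simp
  have h1 : (Q ⊗ₖ (1 : Mat L)) * (P ⊗ₖ (1 : Mat L)) = 1 := by
    rw [← Matrix.mul_kronecker_mul, hQP]; simp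
  have hm := mk_trace_homSubst_mul_charpolyRev (fun p : Fin L × Fin L => l p.1) h1
  rw [← hker, charpolyRev_kronecker_one, Polynomial.coe_pow] at hm
  have := (left_inv_eq_right_inv (mk_eval_szegoPoly_mul_charpolyRev A)
    ((mul_comm _ _).trans hm))
  simpa using congrArg (PowerSeries.coeff k) this

lemma eval_szegoPoly_conj {P Q : Mat L} (A : Mat L) (h : Q * P = 1) (k : ℕ) :
    eval (entries (P * A * Q)) (szegoPoly L k) = eval (entries A) (szegoPoly L k) := by
  have h1 := mk_eval_szegoPoly_mul_charpolyRev (P * A * Q)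
  rw [charpolyRev_conj _ h] at h1
  have := (left_inv_eq_right_inv h1
    ((mul_comm _ _).trans (mk_eval_szegoPoly_mul_charpolyRev A)))
  simpa using congrArg (PowerSeries.coeff k) this

lemma eval_smul_of_isHomogeneous {σ : Type*} {p : MvPolynomial σ ℂ} {k : ℕ}
    (hp : p.IsHomogeneous k) (c : ℂ) (x : σ → ℂ) : eval (c • x) p = c ^ k * eval x p := by
  rw [eval_eq, eval_eq, Finset.mul_sum]
  refine Finset.sum_congr rfl fun d hd => ?_
  have hk : k = ∑ i ∈ d.support, d i := (hp.degree_eq_sum_deg_support hd)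
  simp only [Pi.smul_apply, smul_eq_mul, mul_pow, Finset.prod_mul_distrib,
    Finset.prod_pow_eq_pow_sum, ← hk]
  ring

lemma eval_szegoPoly_smul {A : Mat L} (c : ℂ) (hA : A ∈ Matrix.unitaryGroup (Fin L) ℂ)
    (hcA : c • A ∈ Matrix.unitaryGroup (Fin L) ℂ) (k : ℕ) :
    eval (entries (c • A)) (szegoPoly L k) = c ^ k * eval (entries A) (szegoPoly L k) := by
  rw [eval_szegoPoly_eq_trace hA, eval_szegoPoly_eq_trace hcA, ← smul_eq_mul, ← map_smul]
  congr 1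
  refine LinearMap.ext fun p => homogeneousSubmodule_ext fun x => ?_
  rw [LinearMap.smul_apply, Submodule.coe_smul, smul_eval, eval_homSubst, eval_homSubst,
    Matrix.smul_kronecker, Matrix.smul_mulVec, eval_smul_of_isHomogeneous p.2]

end SzegoCoefficients

section UnitaryDensity

open MvPolynomial Filter Topology
open scoped Matrix.Norms.Operator

variable {L : ℕ}

lemma differentiable_eval_entries_comp {g : ℂ → Mat L} (hg : Differentiable ℂ g)
    (p : MvPolynomial (Fin L × Fin L) ℂ) :
    Differentiable ℂ fun t => eval (entries (g t)) p := by
  have hentry (q : Fin L × Fin L) : Differentiable ℂ fun t => g t q.1 q.2 :=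
    (LinearMap.toContinuousLinearMap (Matrix.entryLinearMap ℂ ℂ q.1 q.2)).differentiable.comp hg
  induction p using MvPolynomial.induction_on with
  | C a => simp
  | add p q hp hq => simp only [map_add]; exact hp.add hq
  | mul_X p i hp => simp only [map_mul, eval_X]; exact hp.mul (hentry i)

/-- An entire function vanishing on the real line vanishes identically. -/
lemma eq_zero_of_forall_real_eq_zero {g : ℂ → ℂ} (hg : Differentiable ℂ g)
    (h : ∀ t : ℝ, g t = 0) (z : ℂ) : g z = 0 := by
  have hfreq : ∃ᶠ z in 𝓝[≠] (0 : ℂ), g z = (fun _ => (0 : ℂ)) z := by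
    have ht : Tendsto (fun t : ℝ => (t : ℂ)) (𝓝[≠] 0) (𝓝[≠] 0) := by
      refine tendsto_nhdsWithin_iff.2 ⟨?_, ?_⟩
      · exact (Complex.continuous_ofReal.tendsto' 0 0 (by simp)).mono_left nhdsWithin_le_nhds
      · filter_upwards [self_mem_nhdsWithin] with t ht
        simpa using ht
    exact ht.frequently (Eventually.frequently (Eventually.of_forall h))
  exact congrFun (AnalyticOnNhd.eq_of_frequently_eq
    (fun z _ => hg.analyticAt z) (fun z _ => analyticAt_const) hfreq) z

lemma eval_entries_exp_eq_zero {G : MvPolynomial (Fin L × Fin L) ℂ}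
    (hG : ∀ U ∈ Matrix.unitaryGroup (Fin L) ℂ, eval (entries U) G = 0) (A : Mat L) :
    eval (entries (NormedSpace.exp A)) G = 0 := by
  set S : Mat L := (2⁻¹ : ℂ) • (A - star A) with hS
  set T : Mat L := (-Complex.I * 2⁻¹) • (A + star A) with hT
  have hSs : star S = -S := by
    simp only [hS, star_smul, star_sub, star_star, ← smul_neg, neg_sub]
    congr 1
    simp
  have hTs : star T = -T := by
    simp only [hT, star_smul, star_add, star_star, ← neg_smul]
    rw [add_comm]
    congr 1
    simp
  have hA : A = S + Complex.I • T := by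
    have : Complex.I * (-Complex.I * 2⁻¹) = (2⁻¹ : ℂ) := by
      rw [← mul_assoc, mul_neg, Complex.I_mul_I]; norm_num
    rw [hS, hT, smul_smul, this, ← smul_add, sub_add_add_cancel, ← two_smul ℂ A, smul_smul]
    norm_num
  clear_value S T
  have hc : ContinuousStar (Mat L) := inferInstance
  let _ : NormedAlgebra ℚ (Mat L) := NormedAlgebra.restrictScalars ℚ ℂ (Mat L)
  have hd : Differentiable ℂ fun t : ℂ => NormedSpace.exp (S + t • T) := fun t =>
    (NormedSpace.exp_analytic (𝕂 := ℂ) (S + t • T)).differentiableAt.comp t (by fun_prop)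
  have := eq_zero_of_forall_real_eq_zero (differentiable_eval_entries_comp hd G) (fun t => by
    refine hG _ (@NormedSpace.exp_mem_unitary_of_mem_skewAdjoint (Mat L) _ _ _ _ hc _ ?_)
    rw [skewAdjoint.mem_iff, star_add, star_smul, hSs, hTs, Complex.star_def, Complex.conj_ofReal,
      smul_neg, neg_add]) Complex.I
  rw [hA]
  exact this

/-- The unitary group is Zariski dense in the space of all matrices. -/
theorem eq_zero_of_forall_unitary_eval_eq_zero {G : MvPolynomial (Fin L × Fin L) ℂ}
    (hG : ∀ U ∈ Matrix.unitaryGroup (Fin L) ℂ, eval (entries U) G = 0) : G = 0 := by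
  have hmap : map (NormedSpace.exp : Mat L → Mat L) (𝓝 0) = 𝓝 (NormedSpace.exp 0) :=
    (hasStrictFDerivAt_exp_zero (𝕂 := ℂ) (𝔸 := Mat L)).map_nhds_eq_of_equiv
      (f' := ContinuousLinearEquiv.refl ℂ _)
  have hnear : ∀ᶠ B in 𝓝 (NormedSpace.exp (0 : Mat L)), eval (entries B) G = 0 := by
    rw [← hmap, eventually_map]
    exact Eventually.of_forall fun A => eval_entries_exp_eq_zero hG A
  rw [NormedSpace.exp_zero] at hnear
  have hof : Continuous fun x : Fin L × Fin L → ℂ => (Matrix.of fun i j => x (i, j) : Mat L) :=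
    continuous_pi fun i => continuous_pi fun j => continuous_apply (i, j)
  have hnear' : ∀ᶠ x in 𝓝 (entries (1 : Mat L)), eval x G = 0 :=
    (hof.tendsto' (entries (1 : Mat L)) 1 rfl).eventually hnear
  obtain ⟨ε, hε, hball⟩ := Metric.eventually_nhds_iff.1 hnear'
  refine MvPolynomial.funext_set (fun i => Metric.ball (entries (1 : Mat L) i) ε)
    (fun i => infinite_of_mem_nhds _ (Metric.ball_mem_nhds _ hε)) fun x hx => ?_
  rw [map_zero]
  exact hball ((dist_pi_lt_iff hε).2 fun i => hx i trivial)

theorem eq_of_forall_unitary_eval_eq {G H : MvPolynomial (Fin L × Fin L) ℂ}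
    (h : ∀ U ∈ Matrix.unitaryGroup (Fin L) ℂ, eval (entries U) G = eval (entries U) H) :
    G = H :=
  sub_eq_zero.1 <| eq_zero_of_forall_unitary_eval_eq_zero fun U hU => by
    rw [map_sub, h U hU, sub_self]

end UnitaryDensity

section Reproducing

open ComplexConjugate

variable {X : Type*} [TopologicalSpace X] [CompactSpace X] [MeasurableSpace X] [BorelSpace X]
  (μ : Measure X) [IsFiniteMeasureOnCompacts μ]

lemma Continuous.integrable_of_compactSpace {E : Type*} [NormedAddCommGroup E] {g : X → E}
    (hg : Continuous g) : Integrable g μ :=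
  hg.integrable_of_hasCompactSupport (HasCompactSupport.of_compactSpace g)

lemma integral_integral_swap_of_compactSpace {Y : Type*} [TopologicalSpace Y] [CompactSpace Y]
    [MeasurableSpace Y] [BorelSpace Y] (ν : Measure Y) [IsFiniteMeasureOnCompacts ν]
    {F : X → Y → ℂ} (hF : Continuous (Function.uncurry F)) :
    ∫ x, ∫ y, F x y ∂ν ∂μ = ∫ y, ∫ x, F x y ∂μ ∂ν :=
  integral_integral_swap_of_hasCompactSupport hF (HasCompactSupport.of_compactSpace _)

lemma continuous_integral_of_compactSpace {Y : Type*} [TopologicalSpace Y] [LocallyCompactSpace Y]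
    [FirstCountableTopology Y] {F : Y → X → ℂ} (hF : Continuous (Function.uncurry F)) :
    Continuous fun y => ∫ x, F y x ∂μ := by
  simpa using continuous_parametric_integral_of_continuous (μ := μ) hF isCompact_univ

/-- A finite-dimensional space of continuous functions has an orthonormal basis in `L²(μ)`. -/
lemma exists_orthonormal_family [μ.IsOpenPosMeasure] {V : Type*} [AddCommGroup V] [Module ℂ V]
    [FiniteDimensional ℂ V] (φ : V →ₗ[ℂ] X → ℂ) (hφ : ∀ v, Continuous (φ v))
    (hinj : ∀ v, φ v = 0 → v = 0) :
    ∃ (n : ℕ) (e : Fin n → V),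
      (∀ v, ∑ i, (∫ x, conj (φ (e i) x) * φ v x ∂μ) • e i = v) ∧
      ∀ T : V →ₗ[ℂ] V,
        LinearMap.trace ℂ V T = ∑ i, ∫ x, conj (φ (e i) x) * φ (T (e i)) x ∂μ := by
  have hint (v w : V) : Integrable (fun x => conj (φ v x) * φ w x) μ :=
    Continuous.integrable_of_compactSpace μ ((Complex.continuous_conj.comp (hφ v)).mul (hφ w))
  have hself (v : V) : ∫ x, conj (φ v x) * φ v x ∂μ = ((∫ x, ‖φ v x‖ ^ 2 ∂μ : ℝ) : ℂ) := by
    rw [← integral_complex_ofReal]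
    refine integral_congr_ae (Filter.Eventually.of_forall fun x => ?_)
    simp only [Complex.ofReal_pow]
    exact Complex.conj_mul' _
  let core : InnerProductSpace.Core ℂ V :=
    { inner := fun v w => ∫ x, conj (φ v x) * φ w x ∂μ
      conj_inner_symm := fun v w => by
        rw [← integral_conj]
        simp [mul_comm]
      re_inner_nonneg := fun v => by
        rw [hself]
        simpa using integral_nonneg fun x => by positivity
      add_left := fun u v w => by
        rw [← integral_add (hint _ _) (hint _ _)]
        simp [add_mul]
      smul_left := fun u v r => by
        rw [← integral_const_mul]
        simp [mul_assoc]
      definite := fun v hv => by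
        refine hinj v (funext fun x => ?_)
        by_contra hx
        have hpos := Continuous.integral_pos_of_hasCompactSupport_nonneg_nonzero (μ := μ)
          (f := fun x => ‖φ v x‖ ^ 2) (x := x) ((hφ v).norm.pow 2)
          (HasCompactSupport.of_compactSpace _) (fun x => by positivity) (by simpa using hx)
        exact hpos.ne' (by exact_mod_cast (hself v).symm.trans hv) }
  let _ : NormedAddCommGroup V := core.toNormedAddCommGroup
  let _ : InnerProductSpace ℂ V := InnerProductSpace.ofCore core.toCore
  let b := stdOrthonormalBasis ℂ V
  exact ⟨_, b, fun v => b.sum_repr' v, fun T => LinearMap.trace_eq_sum_inner T b⟩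

/-- The character of the left translation representation on a finite-dimensional bi-invariant
space of functions on a compact group reproduces the functions of this space. -/
theorem integral_mul_trace_translation {G : Type*} [Group G] [TopologicalSpace G]
    [IsTopologicalGroup G] [CompactSpace G] [FirstCountableTopology G] [MeasurableSpace G]
    [BorelSpace G]
    (μ : Measure G) [μ.IsHaarMeasure] {V : Type*} [AddCommGroup V]
    [Module ℂ V] [FiniteDimensional ℂ V] (φ : V →ₗ[ℂ] G → ℂ) (hφ : ∀ v, Continuous (φ v))
    (hinj : ∀ v, φ v = 0 → v = 0) (R : G → V →ₗ[ℂ] V) (hR : ∀ u v x, φ (R u v) x = φ v (u⁻¹ * x))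
    (S : G → V → V) (hS : ∀ u v x, φ (S u v) x = φ v (x * u)) (v : V) :
    ∫ u, φ v u * LinearMap.trace ℂ V (R u) ∂μ = (∫ _, (1 : ℂ) ∂μ) * φ v 1 := by
  obtain ⟨n, e, he, htr⟩ := exists_orthonormal_family μ φ hφ hinj
  have hconj (i : Fin n) : Continuous fun x => conj (φ (e i) x) :=
    Complex.continuous_conj.comp (hφ _)
  have hsub (i : Fin n) :
      ∫ u, φ v u * ∫ x, conj (φ (e i) x) * φ (e i) (u⁻¹ * x) ∂μ ∂μ =
        ∫ u, (∫ x, conj (φ (e i) x) * φ v (x * u) ∂μ) * φ (e i) u⁻¹ ∂μ := by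
    calc _ = ∫ u, ∫ x, φ v u * (conj (φ (e i) x) * φ (e i) (u⁻¹ * x)) ∂μ ∂μ := by
          simp_rw [integral_const_mul]
      _ = ∫ x, ∫ u, φ v u * (conj (φ (e i) x) * φ (e i) (u⁻¹ * x)) ∂μ ∂μ := by
          refine integral_integral_swap_of_compactSpace μ μ ?_
          exact ((hφ v).comp continuous_fst).mul (((hconj i).comp continuous_snd).mul
            ((hφ (e i)).comp (continuous_fst.inv.mul continuous_snd)))
      _ = ∫ x, ∫ u, φ v (x * u) * (conj (φ (e i) x) * φ (e i) u⁻¹) ∂μ ∂μ := by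
          refine integral_congr_ae (Filter.Eventually.of_forall fun x => ?_)
          simp only
          rw [← integral_mul_left_eq_self _ x]
          simp
      _ = ∫ u, ∫ x, φ v (x * u) * (conj (φ (e i) x) * φ (e i) u⁻¹) ∂μ ∂μ := by
          refine integral_integral_swap_of_compactSpace μ μ ?_
          exact ((hφ v).comp (continuous_fst.mul continuous_snd)).mul
            (((hconj i).comp continuous_fst).mul ((hφ (e i)).comp continuous_snd.inv))
      _ = _ := by
          refine integral_congr_ae (Filter.Eventually.of_forall fun u => ?_)
          simp only
          rw [← integral_mul_const]
          exact integral_congr_ae (Filter.Eventually.of_forall fun x => by ring)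
  have hcont₁ (i : Fin n) : Continuous fun u =>
      φ v u * ∫ x, conj (φ (e i) x) * φ (e i) (u⁻¹ * x) ∂μ :=
    (hφ v).mul <| continuous_integral_of_compactSpace μ <| ((hconj i).comp continuous_snd).mul
      ((hφ (e i)).comp (continuous_fst.inv.mul continuous_snd))
  have hcont₂ (i : Fin n) : Continuous fun u =>
      (∫ x, conj (φ (e i) x) * φ v (x * u) ∂μ) * φ (e i) u⁻¹ := by
    refine Continuous.mul ?_ ((hφ (e i)).comp continuous_inv)
    exact continuous_integral_of_compactSpace μ <| ((hconj i).comp continuous_snd).mul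
      ((hφ v).comp (continuous_snd.mul continuous_fst))
  calc ∫ u, φ v u * LinearMap.trace ℂ V (R u) ∂μ
      = ∫ u, ∑ i, φ v u * ∫ x, conj (φ (e i) x) * φ (e i) (u⁻¹ * x) ∂μ ∂μ := by
        simp_rw [htr, hR, Finset.mul_sum]
    _ = ∑ i, ∫ u, φ v u * ∫ x, conj (φ (e i) x) * φ (e i) (u⁻¹ * x) ∂μ ∂μ :=
        integral_finsetSum _ fun i _ => Continuous.integrable_of_compactSpace μ (hcont₁ i)
    _ = ∑ i, ∫ u, (∫ x, conj (φ (e i) x) * φ v (x * u) ∂μ) * φ (e i) u⁻¹ ∂μ :=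
        Finset.sum_congr rfl fun i _ => hsub i
    _ = ∫ u, ∑ i, (∫ x, conj (φ (e i) x) * φ v (x * u) ∂μ) * φ (e i) u⁻¹ ∂μ :=
        (integral_finsetSum _ fun i _ => Continuous.integrable_of_compactSpace μ (hcont₂ i)).symm
    _ = ∫ _, φ v 1 ∂μ := by
        refine integral_congr_ae (Filter.Eventually.of_forall fun u => ?_)
        have := congrArg (fun w => φ w u⁻¹) (he (S u v))
        simpa [hS, map_sum] using this
    _ = _ := by rw [← integral_mul_const]; simp

end Reproducing

section UnitaryReproducing

open MvPolynomial
open scoped Kronecker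

variable {L : ℕ}

instance : BorelSpace (Matrix.unitaryGroup (Fin L) ℂ) := ⟨rfl⟩

instance : CompactSpace (Matrix.unitaryGroup (Fin L) ℂ) := by
  refine isCompact_iff_compactSpace.1 ?_
  have hK : IsCompact (Set.univ.pi fun _ : Fin L => Set.univ.pi fun _ : Fin L =>
      Metric.closedBall (0 : ℂ) 1) :=
    isCompact_univ_pi fun _ => isCompact_univ_pi fun _ => isCompact_closedBall _ _
  refine hK.of_isClosed_subset ?_ fun U hU i _ j _ => ?_
  · exact (isClosed_unitary : IsClosed (unitary (Mat L) : Set (Mat L)))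
  · simpa using entry_norm_bound_of_unitary hU i j

instance : FirstCountableTopology (Matrix.unitaryGroup (Fin L) ℂ) :=
  have : FirstCountableTopology (Mat L) :=
    inferInstanceAs (FirstCountableTopology (Fin L → Fin L → ℂ))
  Topology.IsInducing.subtypeVal.firstCountableTopology

lemma continuous_entries : Continuous (entries : Mat L → _) :=
  continuous_pi fun p => (continuous_apply p.2).comp (continuous_apply p.1)

lemma continuous_eval_entries {X : Type*} [TopologicalSpace X] {g : X → Mat L}
    (hg : Continuous g) (p : MvPolynomial (Fin L × Fin L) ℂ) :
    Continuous fun x => eval (entries (g x)) p :=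
  (MvPolynomial.continuous_eval p).comp (continuous_entries.comp hg)

variable (μ : Measure (Matrix.unitaryGroup (Fin L) ℂ)) [μ.IsHaarMeasure]

/-- Averaging a polynomial of `Z U*` against a function of `U` gives a polynomial of `Z`. -/
lemma exists_eval_eq_integral_mul_eval {h : Matrix.unitaryGroup (Fin L) ℂ → ℂ} (hh : Continuous h)
    (Q : MvPolynomial (Fin L × Fin L) ℂ) :
    ∃ G : MvPolynomial (Fin L × Fin L) ℂ, ∀ Z : Mat L, eval (entries Z) G =
      ∫ U : Matrix.unitaryGroup (Fin L) ℂ, h U * eval (entries (Z * (U : Mat L)ᴴ)) Q ∂μ := by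
  have hstar : Continuous fun U : Matrix.unitaryGroup (Fin L) ℂ => (U : Mat L)ᴴ :=
    continuous_subtype_val.matrix_conjTranspose
  induction Q using MvPolynomial.induction_on generalizing h with
  | C a => exact ⟨C (∫ U, h U * a ∂μ), fun Z => by simp⟩
  | add p q hp hq =>
    obtain ⟨G, hG⟩ := hp hh
    obtain ⟨H, hH⟩ := hq hh
    refine ⟨G + H, fun Z => ?_⟩
    rw [map_add, hG, hH, ← integral_add]
    · simp [mul_add]
    all_goals
      exact Continuous.integrable_of_compactSpace μ
        (hh.mul (continuous_eval_entries (continuous_const.matrix_mul hstar) _))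
  | mul_X p ij hp =>
    have hentry (l : Fin L) : Continuous fun U : Matrix.unitaryGroup (Fin L) ℂ =>
        h U * (U : Mat L)ᴴ l ij.2 := hh.mul (hstar.matrix_elem l ij.2)
    choose G hG using fun l => hp (hentry l)
    refine ⟨∑ l, X (ij.1, l) * G l, fun Z => ?_⟩
    simp only [map_sum, map_mul, eval_X, hG]
    simp_rw [← integral_const_mul]
    rw [← integral_finsetSum]
    · refine integral_congr_ae (Filter.Eventually.of_forall fun U => ?_)
      simp only [entries, Matrix.mul_apply, Finset.mul_sum]
      exact Finset.sum_congr rfl fun l _ => by ring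
    · exact fun l _ => Continuous.integrable_of_compactSpace μ (continuous_const.mul
        ((hentry l).mul (continuous_eval_entries (continuous_const.matrix_mul hstar) _)))

variable [IsProbabilityMeasure μ]

lemma integral_eval_mul_eval_szegoPoly_star {p : MvPolynomial (Fin L × Fin L) ℂ} {k : ℕ}
    (hp : p.IsHomogeneous k) :
    ∫ U : Matrix.unitaryGroup (Fin L) ℂ, eval (entries (U : Mat L)) p *
      eval (entries (U : Mat L)ᴴ) (szegoPoly L k) ∂μ = eval (entries (1 : Mat L)) p := by
  let φ : homogeneousSubmodule (Fin L × Fin L) ℂ k →ₗ[ℂ] Matrix.unitaryGroup (Fin L) ℂ → ℂ :=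
    { toFun := fun q U => eval (entries (U : Mat L)) (q : MvPolynomial (Fin L × Fin L) ℂ)
      map_add' := fun q r => by ext; simp
      map_smul' := fun c q => by ext; simp [smul_eval] }
  have : Finite {d : Fin L × Fin L →₀ ℕ | d.degree = k} :=
    Set.Finite.subset (Finset.finite_toSet (Finset.finsuppAntidiag Finset.univ k)) fun d hd => by
      simpa [Finsupp.degree_eq_sum] using hd
  have : FiniteDimensional ℂ (homogeneousSubmodule (Fin L × Fin L) ℂ k) :=
    Module.Finite.of_basis (homogeneousBasis _ k)
  have := integral_mul_trace_translation μ φ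
    (fun q => continuous_eval_entries continuous_subtype_val _)
    (fun q hq => Subtype.ext <| eq_zero_of_forall_unitary_eval_eq_zero fun U hU =>
      congrFun hq ⟨U, hU⟩)
    (fun U => homSubst k ((U : Mat L)ᴴ ⊗ₖ (1 : Mat L)))
    (fun U q x => by
      simp only [φ, LinearMap.coe_mk, AddHom.coe_mk, eval_homSubst,
        kronecker_one_mulVec_entries]
      rfl)
    (fun U => homSubst k ((1 : Mat L) ⊗ₖ (U : Mat L)ᵀ))
    (fun U q x => by
      simp only [φ, LinearMap.coe_mk, AddHom.coe_mk, eval_homSubst,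
        one_kronecker_transpose_mulVec_entries]
      rfl)
    ⟨p, hp⟩
  simp only [integral_const, probReal_univ, one_smul, one_mul] at this
  refine Eq.trans (integral_congr_ae (Filter.Eventually.of_forall fun U => ?_)) this
  simp only
  rw [eval_szegoPoly_eq_trace]
  · rfl
  · exact Unitary.star_mem U.2

lemma integral_eval_mul_eval_szegoPoly_unitary {p : MvPolynomial (Fin L × Fin L) ℂ} {k : ℕ}
    (hp : p.IsHomogeneous k) (V : Matrix.unitaryGroup (Fin L) ℂ) :
    ∫ U : Matrix.unitaryGroup (Fin L) ℂ, eval (entries (U : Mat L)) p *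
      eval (entries ((V : Mat L) * (U : Mat L)ᴴ)) (szegoPoly L k) ∂μ =
        eval (entries (V : Mat L)) p := by
  have h := integral_eval_mul_eval_szegoPoly_star μ
    (homSubst k ((V : Mat L) ⊗ₖ (1 : Mat L)) ⟨p, hp⟩).2
  have hV : star (V : Mat L) * V = 1 := V.2.1
  have hV' : (V : Mat L) * star (V : Mat L) = 1 := V.2.2
  simp only [eval_homSubst, kronecker_one_mulVec_entries, mul_one] at h
  rw [← h, ← integral_mul_left_eq_self _ V]
  refine integral_congr_ae (Filter.Eventually.of_forall fun U => ?_)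
  simp only [Submonoid.coe_mul, conjTranspose_mul]
  rw [← Matrix.mul_assoc, ← star_eq_conjTranspose (V : Mat L), eval_szegoPoly_conj _ hV]

/-- The degree `k` part of the Szegő kernel reproduces homogeneous polynomials of degree `k`. -/
theorem integral_eval_mul_eval_szegoPoly {p : MvPolynomial (Fin L × Fin L) ℂ} {k : ℕ}
    (hp : p.IsHomogeneous k) (Z : Mat L) :
    ∫ U : Matrix.unitaryGroup (Fin L) ℂ, eval (entries (U : Mat L)) p *
      eval (entries (Z * (U : Mat L)ᴴ)) (szegoPoly L k) ∂μ = eval (entries Z) p := by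
  obtain ⟨G, hG⟩ := exists_eval_eq_integral_mul_eval μ
    (continuous_eval_entries continuous_subtype_val p) (szegoPoly L k)
  rw [← hG, eq_of_forall_unitary_eval_eq fun V hV => (hG V).trans
    (integral_eval_mul_eval_szegoPoly_unitary μ hp ⟨V, hV⟩)]

end UnitaryReproducing

section TaylorExpansion

open MvPolynomial Metric

variable {L : ℕ}

lemma one_sub_smul_eq (Y : Mat L) (t : ℂ) :
    1 - (t • Y)ᴴ * (t • Y) =
      (1 - ‖t‖ ^ 2) • (1 : Mat L) + (‖t‖ ^ 2) • (1 - Yᴴ * Y) := by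
  have h : (star t * t) = ((‖t‖ ^ 2 : ℝ) : ℂ) := by
    rw [Complex.star_def, Complex.conj_mul']; push_cast; rfl
  rw [conjTranspose_smul, Matrix.smul_mul, Matrix.mul_smul, smul_smul, h, Complex.coe_smul,
    sub_smul, one_smul, smul_sub]
  abel

lemma posSemidef_one_sub_smul {Y : Mat L} (hY : (1 - Yᴴ * Y).PosSemidef) {t : ℂ} (ht : ‖t‖ ≤ 1) :
    (1 - (t • Y)ᴴ * (t • Y)).PosSemidef := by
  rw [one_sub_smul_eq]
  exact (PosSemidef.one.smul (by nlinarith [norm_nonneg t])).add (hY.smul (by positivity))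

lemma posDef_one_sub_smul {Y : Mat L} (hY : (1 - Yᴴ * Y).PosSemidef) {t : ℂ} (ht : ‖t‖ < 1) :
    (1 - (t • Y)ᴴ * (t • Y)).PosDef := by
  rw [one_sub_smul_eq]
  exact (PosDef.one.smul (by nlinarith [norm_nonneg t])).add_posSemidef (hY.smul (by positivity))

lemma posSemidef_one_sub_of_mem_unitaryGroup {U : Mat L} (hU : U ∈ Matrix.unitaryGroup (Fin L) ℂ) :
    (1 - Uᴴ * U).PosSemidef := by
  have : Uᴴ * U = 1 := hU.1
  rw [this, sub_self]
  exact PosSemidef.zero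

/-- The diagonal values of a multilinear form on matrices are given by a homogeneous polynomial. -/
lemma exists_isHomogeneous_eval_eq {k : ℕ}
    (m : MultilinearMap ℂ (fun _ : Fin k => Fin L → Fin L → ℂ) ℂ) :
    ∃ P : MvPolynomial (Fin L × Fin L) ℂ, P.IsHomogeneous k ∧
      ∀ Y : Mat L, eval (entries Y) P = m fun _ => Matrix.of.symm Y := by
  let b : Fin L × Fin L → Fin L → Fin L → ℂ := fun p i j => if p = (i, j) then 1 else 0
  refine ⟨∑ r : Fin k → Fin L × Fin L, C (m fun i => b (r i)) * ∏ i, X (r i), ?_, fun Y => ?_⟩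
  · refine IsHomogeneous.sum _ _ _ fun r _ => ?_
    simpa using (isHomogeneous_C _ (m fun i => b (r i))).mul
      (IsHomogeneous.prod Finset.univ (fun i : Fin k => (X (r i) : MvPolynomial _ ℂ))
        (fun _ => 1) fun i _ => isHomogeneous_X _ _)
  · have hY : Matrix.of.symm Y = ∑ p, entries Y p • b p := by
      ext i j
      simp [b, entries, Finset.sum_apply]
    rw [hY, MultilinearMap.map_sum]
    simp [MultilinearMap.map_smul_univ, mul_comm]

theorem exists_taylor_polynomials {f : Mat L → ℂ}
    (hcont : ContinuousOn (fun x : Fin L → Fin L → ℂ => f (Matrix.of x))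
      {x : Fin L → Fin L → ℂ | ((1 : Mat L) - (Matrix.of x)ᴴ * Matrix.of x).PosSemidef})
    (hanal : AnalyticOnNhd ℂ (fun x : Fin L → Fin L → ℂ => f (Matrix.of x))
      {x : Fin L → Fin L → ℂ | ((1 : Mat L) - (Matrix.of x)ᴴ * Matrix.of x).PosDef}) :
    ∃ P : ℕ → MvPolynomial (Fin L × Fin L) ℂ, (∀ k, (P k).IsHomogeneous k) ∧
      ∀ Y : Mat L, (1 - Yᴴ * Y).PosSemidef →
        (∀ s : ℂ, ‖s‖ < 1 → HasSum (fun k => s ^ k * eval (entries Y) (P k)) (f (s • Y))) ∧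
        ∀ k, (2 * Real.pi * Complex.I : ℂ)⁻¹ * (∮ z in C(0, 1), z⁻¹ ^ k * (z⁻¹ * f (z • Y))) =
          eval (entries Y) (P k) := by
  obtain ⟨p, hp⟩ := hanal 0 (by
    have : ((1 : Mat L) - (0 : Mat L)ᴴ * (0 : Mat L)).PosDef := by simpa using PosDef.one
    exact this)
  choose P hP hPe using fun k => exists_isHomogeneous_eval_eq (p k).toMultilinearMap
  refine ⟨P, hP, fun Y hY => ?_⟩
  let y : Fin L → Fin L → ℂ := Matrix.of.symm Y
  let u : ℂ →L[ℂ] (Fin L → Fin L → ℂ) := ContinuousLinearMap.toSpanSingleton ℂ y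
  have hd : DiffContOnCl ℂ (fun t : ℂ => f (t • Y)) (ball 0 ((1 : NNReal) : ℝ)) := by
    refine ⟨fun t ht => ?_, ?_⟩
    · have := (hanal (t • y) (posDef_one_sub_smul hY (by simpa using ht))).differentiableAt
      exact (this.comp t (f := fun t : ℂ => t • y) (by fun_prop)).differentiableWithinAt
    · refine hcont.comp (f := fun t : ℂ => t • y) (by fun_prop) fun t ht => ?_
      rw [closure_ball _ (by simp)] at ht
      exact posSemidef_one_sub_smul hY (by simpa using ht)
  have h1 := hd.hasFPowerSeriesOnBall zero_lt_one
  have h2 : HasFPowerSeriesAt (fun t : ℂ => f (t • Y)) (p.compContinuousLinearMap u) 0 :=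
    HasFPowerSeriesAt.compContinuousLinearMap (u := u) (x := 0)
      (f := fun x => f (Matrix.of x)) (by rwa [map_zero])
  have heq := h1.hasFPowerSeriesAt.eq_formalMultilinearSeries h2
  have hcoef (k : ℕ) (s : ℂ) : cauchyPowerSeries (fun t : ℂ => f (t • Y)) 0 ((1 : NNReal) : ℝ) k
      (fun _ => s) = s ^ k * eval (entries Y) (P k) := by
    rw [heq, FormalMultilinearSeries.compContinuousLinearMap_apply, hPe]
    have : (u ∘ fun _ : Fin k => s) = fun _ => s • y := by ext; simp [u]
    rw [this]
    simpa using (p k).map_smul_univ (fun _ => s) (fun _ => y)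
  refine ⟨fun s hs => ?_, fun k => ?_⟩
  · have := h1.hasSum (y := s) (by simpa [← ofReal_norm] using hs)
    simpa only [hcoef, zero_add] using this
  · have := hcoef k 1
    rw [cauchyPowerSeries_apply] at this
    simpa using this

end TaylorExpansion

section TaylorReproducing

open MvPolynomial

variable {L : ℕ} (μ : Measure (Matrix.unitaryGroup (Fin L) ℂ)) [μ.IsHaarMeasure]

lemma intervalIntegral_integral_swap_of_continuous {X : Type*} [TopologicalSpace X]
    [CompactSpace X] [MeasurableSpace X] [BorelSpace X] (ν : Measure X) [IsFiniteMeasure ν]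
    {F : ℝ → X → ℂ} (hF : Continuous (Function.uncurry F)) (a b : ℝ) :
    ∫ θ in a..b, ∫ x, F θ x ∂ν = ∫ x, (∫ θ in a..b, F θ x) ∂ν := by
  refine intervalIntegral_integral_swap ?_
  obtain ⟨C, hC⟩ := (isCompact_uIcc.prod isCompact_univ :
    IsCompact (Set.uIcc a b ×ˢ (Set.univ : Set X))).exists_bound_of_continuousOn hF.continuousOn
  have : IsFiniteMeasure (volume.restrict (Set.uIoc a b)) :=
    inferInstanceAs (IsFiniteMeasure (volume.restrict (Set.Ioc (min a b) (max a b))))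
  refine Integrable.of_bound hF.aestronglyMeasurable C ?_
  have : ∀ᵐ z ∂((volume.restrict (Set.uIoc a b)).prod ν), z.1 ∈ Set.uIoc a b :=
    Measure.quasiMeasurePreserving_fst.ae (ae_restrict_mem measurableSet_uIoc)
  filter_upwards [this] with z hz
  exact hC z ⟨Set.uIoc_subset_uIcc hz, trivial⟩

lemma smul_mem_unitaryGroup {c : ℂ} (hc : ‖c‖ = 1) {U : Mat L}
    (hU : U ∈ Matrix.unitaryGroup (Fin L) ℂ) : c • U ∈ Matrix.unitaryGroup (Fin L) ℂ := by
  have hcc : c * star c = 1 := by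
    rw [Complex.star_def, Complex.mul_conj', hc]; simp
  rw [Matrix.mem_unitaryGroup_iff, star_smul, Matrix.smul_mul, Matrix.mul_smul, smul_smul, hcc,
    Matrix.mem_unitaryGroup_iff.1 hU, one_smul]

lemma integral_eval_szegoPoly_mul_smul {f : Mat L → ℂ} (k : ℕ)
    (V : Matrix.unitaryGroup (Fin L) ℂ) {c : ℂ} (hc : ‖c‖ = 1) :
    ∫ U : Matrix.unitaryGroup (Fin L) ℂ, c⁻¹ ^ k *
        (eval (entries ((V : Mat L) * (U : Mat L)ᴴ)) (szegoPoly L k) * f (c • (U : Mat L))) ∂μ =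
      ∫ U : Matrix.unitaryGroup (Fin L) ℂ,
        eval (entries ((V : Mat L) * (U : Mat L)ᴴ)) (szegoPoly L k) * f (U : Mat L) ∂μ := by
  have hcs : star c = c⁻¹ := by
    rw [Complex.inv_def, Complex.normSq_eq_norm_sq, hc]; simp
  let W : Matrix.unitaryGroup (Fin L) ℂ :=
    ⟨c • 1, smul_mem_unitaryGroup hc (one_mem _)⟩
  have hVU (U : Matrix.unitaryGroup (Fin L) ℂ) :
      (V : Mat L) * (U : Mat L)ᴴ ∈ Matrix.unitaryGroup (Fin L) ℂ :=
    mul_mem V.2 (Unitary.star_mem U.2)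
  rw [← integral_mul_left_eq_self (fun U : Matrix.unitaryGroup (Fin L) ℂ =>
    eval (entries ((V : Mat L) * (U : Mat L)ᴴ)) (szegoPoly L k) * f (U : Mat L)) W]
  refine integral_congr_ae (Filter.Eventually.of_forall fun U => ?_)
  have h1 : ((W * U : Matrix.unitaryGroup (Fin L) ℂ) : Mat L) = c • (U : Mat L) := by simp [W]
  simp only
  rw [h1, conjTranspose_smul, Matrix.mul_smul, hcs,
    eval_szegoPoly_smul _ (hVU U) (smul_mem_unitaryGroup (by simp [hc]) (hVU U)), mul_assoc]

/-- Integrating against the degree `k` part of the Szegő kernel extracts the Taylor polynomial of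
degree `k`. -/
theorem integral_eval_szegoPoly_mul [IsProbabilityMeasure μ] {f : Mat L → ℂ}
    (hf : ContinuousOn f (Matrix.unitaryGroup (Fin L) ℂ)) {P : MvPolynomial (Fin L × Fin L) ℂ}
    {k : ℕ} (hP : P.IsHomogeneous k)
    (hfP : ∀ U ∈ Matrix.unitaryGroup (Fin L) ℂ, (2 * Real.pi * Complex.I : ℂ)⁻¹ *
      (∮ z in C(0, 1), z⁻¹ ^ k * (z⁻¹ * f (z • U))) = eval (entries U) P) (Z : Mat L) :
    ∫ U : Matrix.unitaryGroup (Fin L) ℂ,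
      eval (entries (Z * (U : Mat L)ᴴ)) (szegoPoly L k) * f (U : Mat L) ∂μ =
        eval (entries Z) P := by
  have hfc : Continuous fun U : Matrix.unitaryGroup (Fin L) ℂ => f (U : Mat L) :=
    hf.comp_continuous continuous_subtype_val fun U => U.2
  obtain ⟨G, hG⟩ := exists_eval_eq_integral_mul_eval μ hfc (szegoPoly L k)
  suffices h : G = P by simp_rw [← h, hG, mul_comm]
  refine eq_of_forall_unitary_eval_eq fun V hV => ?_
  rw [hG]
  have hcirc (U : Matrix.unitaryGroup (Fin L) ℂ) :
      ∫ θ in (0 : ℝ)..2 * Real.pi, (circleMap 0 1 θ)⁻¹ ^ k * f (circleMap 0 1 θ • (U : Mat L)) =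
        2 * Real.pi * eval (entries (U : Mat L)) P := by
    rw [← hfP U U.2, circleIntegral]
    simp only [deriv_circleMap, smul_eq_mul]
    have hz (θ : ℝ) : circleMap 0 1 θ ≠ 0 := circleMap_ne_center one_ne_zero
    have : ∀ θ : ℝ, circleMap 0 1 θ * Complex.I * ((circleMap 0 1 θ)⁻¹ ^ k *
        ((circleMap 0 1 θ)⁻¹ * f (circleMap 0 1 θ • (U : Mat L)))) =
        Complex.I * ((circleMap 0 1 θ)⁻¹ ^ k * f (circleMap 0 1 θ • (U : Mat L))) := fun θ => by
      field_simp [hz θ]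
    simp_rw [this, intervalIntegral.integral_const_mul]
    have hpi : (Real.pi : ℂ) ≠ 0 := by exact_mod_cast Real.pi_ne_zero
    field_simp
  have hpi : (2 * Real.pi : ℂ) ≠ 0 := by
    simp
  have hstar : Continuous fun U : Matrix.unitaryGroup (Fin L) ℂ => V * (U : Mat L)ᴴ :=
    continuous_const.matrix_mul continuous_subtype_val.matrix_conjTranspose
  refine mul_left_cancel₀ hpi ?_
  calc (2 * Real.pi : ℂ) * ∫ U : Matrix.unitaryGroup (Fin L) ℂ,
        f (U : Mat L) * eval (entries (V * (U : Mat L)ᴴ)) (szegoPoly L k) ∂μ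
      = ∫ θ in (0 : ℝ)..2 * Real.pi, ∫ U : Matrix.unitaryGroup (Fin L) ℂ, (circleMap 0 1 θ)⁻¹ ^ k *
        (eval (entries (V * (U : Mat L)ᴴ)) (szegoPoly L k) *
          f (circleMap 0 1 θ • (U : Mat L))) ∂μ := by
        simp_rw [integral_eval_szegoPoly_mul_smul μ (f := f) k ⟨V, hV⟩
          (show ‖circleMap 0 1 _‖ = 1 by simp), mul_comm (f _)]
        simp
    _ = ∫ U : Matrix.unitaryGroup (Fin L) ℂ, (∫ θ in (0 : ℝ)..2 * Real.pi, (circleMap 0 1 θ)⁻¹ ^ k *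
        (eval (entries (V * (U : Mat L)ᴴ)) (szegoPoly L k) *
          f (circleMap 0 1 θ • (U : Mat L)))) ∂μ := by
        refine intervalIntegral_integral_swap_of_continuous μ ?_ _ _
        have hcm : Continuous (circleMap 0 1) := continuous_circleMap 0 1
        refine Continuous.mul (((hcm.comp continuous_fst).inv₀ fun _ =>
          circleMap_ne_center one_ne_zero).pow k) (Continuous.mul
          ((continuous_eval_entries hstar _).comp continuous_snd) ?_)
        refine hf.comp_continuous ((hcm.comp continuous_fst).smul
          (continuous_subtype_val.comp continuous_snd)) fun x =>
            smul_mem_unitaryGroup (by simp) x.2.2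
    _ = ∫ U : Matrix.unitaryGroup (Fin L) ℂ, (2 * Real.pi : ℂ) * (eval (entries (U : Mat L)) P *
          eval (entries (V * (U : Mat L)ᴴ)) (szegoPoly L k)) ∂μ := by
        refine integral_congr_ae (Filter.Eventually.of_forall fun U => ?_)
        simp only
        rw [← mul_assoc, ← hcirc, ← intervalIntegral.integral_mul_const]
        exact intervalIntegral.integral_congr fun θ _ => by ring
    _ = _ := by
        rw [integral_const_mul, integral_eval_mul_eval_szegoPoly μ hP]

end TaylorReproducing

section SzegoKernelExpansion

open MvPolynomial Metric

variable {L : ℕ}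

lemma isUnit_one_sub_mul_conjTranspose {Z : Mat L} (hZ : (1 - Zᴴ * Z).PosDef) {U : Mat L}
    (hU : U ∈ Matrix.unitaryGroup (Fin L) ℂ) : IsUnit (1 - Z * Uᴴ) := by
  rw [← Matrix.mulVec_injective_iff_isUnit, ← Matrix.coe_mulVecLin,
    injective_iff_map_eq_zero]
  intro v hv
  have hUU : U * Uᴴ = 1 := hU.2
  have hv' : v = Z *ᵥ (Uᴴ *ᵥ v) := by
    rw [Matrix.mulVecLin_apply, Matrix.sub_mulVec, Matrix.one_mulVec, sub_eq_zero] at hv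
    rwa [Matrix.mulVec_mulVec]
  obtain ⟨w, hw⟩ : ∃ w, w = Uᴴ *ᵥ v := ⟨_, rfl⟩
  rw [← hw] at hv'
  have hvw : v = U *ᵥ w := by rw [hw, Matrix.mulVec_mulVec, hUU, Matrix.one_mulVec]
  have key : star w ⬝ᵥ ((1 - Zᴴ * Z) *ᵥ w) = 0 := by
    have hiso : star w ⬝ᵥ w = star v ⬝ᵥ v := by
      have h1 : Uᴴ * U = 1 := hU.1
      rw [hvw, Matrix.star_mulVec, ← Matrix.dotProduct_mulVec, Matrix.mulVec_mulVec, h1,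
        Matrix.one_mulVec]
    have hZw : star w ⬝ᵥ ((Zᴴ * Z) *ᵥ w) = star v ⬝ᵥ v := by
      rw [← Matrix.mulVec_mulVec, Matrix.dotProduct_mulVec, ← Matrix.star_mulVec, ← hv']
    rw [Matrix.sub_mulVec, Matrix.one_mulVec, dotProduct_sub, hiso, hZw, sub_self]
  have hw0 : w = 0 := by
    by_contra h
    exact (hZ.dotProduct_mulVec_pos h).ne' key
  rw [hv', hw0, Matrix.mulVec_zero]

open scoped MatrixOrder Matrix.Norms.L2Operator in
/-- Points of the open matrix disc are strict contractions of points of the closed disc. -/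
lemma exists_smul_eq_of_posDef (hL : 1 ≤ L) {Z : Mat L} (hZ : (1 - Zᴴ * Z).PosDef) :
    ∃ (s : ℂ) (Y : Mat L), ‖s‖ < 1 ∧ (1 - Yᴴ * Y).PosSemidef ∧ Z = s • Y := by
  have : Nonempty (Fin L) := ⟨⟨0, hL⟩⟩
  obtain ⟨r, hr, hle⟩ := (CFC.exists_pos_algebraMap_le_iff hZ.isStrictlyPositive.isSelfAdjoint).2
    fun x hx => hZ.isStrictlyPositive.spectrum_pos hx
  rw [Matrix.le_iff] at hle
  have hρ : 1 < √(1 + r) := by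
    rw [Real.lt_sqrt zero_le_one]; linarith
  have hρ0 : ((√(1 + r) : ℝ) : ℂ) ≠ 0 := by
    exact_mod_cast (zero_lt_one.trans hρ).ne'
  refine ⟨((√(1 + r) : ℝ) : ℂ)⁻¹, ((√(1 + r) : ℝ) : ℂ) • Z, ?_, ?_, ?_⟩
  · rw [norm_inv, Complex.norm_real, Real.norm_of_nonneg (Real.sqrt_nonneg _)]
    exact inv_lt_one_of_one_lt₀ hρ
  · rw [one_sub_smul_eq, Complex.norm_real, Real.norm_of_nonneg (Real.sqrt_nonneg _),
      Real.sq_sqrt (by linarith)]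
    have : (1 - (1 + r)) • (1 : Mat L) + (1 + r) • (1 - Zᴴ * Z) =
        (1 - Zᴴ * Z - algebraMap ℝ (Mat L) r) + r • (1 - Zᴴ * Z) := by
      rw [Algebra.algebraMap_eq_smul_one, add_smul, sub_smul, add_smul, one_smul, one_smul]
      abel
    rw [this]
    exact hle.add (hZ.posSemidef.smul hr.le)
  · rw [smul_smul, inv_mul_cancel₀ hρ0, one_smul]

/-- The Taylor series of the reciprocal of a polynomial is its formal inverse. -/
lemma mk_coeff_mul_eq_one {D : Polynomial ℂ} {h : ℂ → ℂ} {q : FormalMultilinearSeries ℂ ℂ ℂ}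
    (hq : HasFPowerSeriesAt h q 0) (hD : ∀ᶠ t in nhds 0, D.eval t * h t = 1) :
    (D : PowerSeries ℂ) * PowerSeries.mk q.coeff = 1 := by
  obtain ⟨r, hr⟩ := hq
  let a : ℕ → ℂ := fun n => PowerSeries.coeff n ((D : PowerSeries ℂ) * PowerSeries.mk q.coeff)
  have hone : HasFPowerSeriesAt (fun _ : ℂ => (1 : ℂ))
      (FormalMultilinearSeries.ofScalars ℂ a) 0 := by
    rw [hasFPowerSeriesAt_iff]
    filter_upwards [eball_mem_nhds (0 : ℂ) hr.r_pos, hD] with t ht hDt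
    have hDsum : HasSum (fun n => D.coeff n * t ^ n) (D.eval t) := by
      rw [Polynomial.eval_eq_sum, Polynomial.sum]
      exact hasSum_sum_of_ne_finset_zero fun n hn => by
        rw [Polynomial.notMem_support_iff.1 hn, zero_mul]
    have hDn : Summable fun n => ‖D.coeff n * t ^ n‖ :=
      summable_of_ne_finset_zero (s := D.support) fun n hn => by
        rw [Polynomial.notMem_support_iff.1 hn, zero_mul, norm_zero]
    have hqsum : HasSum (fun n => t ^ n * q.coeff n) (h t) := by
      simpa [FormalMultilinearSeries.apply_eq_pow_smul_coeff] using hr.hasSum ht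
    have hqn : Summable fun n => ‖t ^ n * q.coeff n‖ := by
      simpa [FormalMultilinearSeries.apply_eq_pow_smul_coeff] using
        q.summable_norm_apply (eball_subset_eball hr.r_le ht)
    have hterm (n : ℕ) : ∑ kl ∈ Finset.HasAntidiagonal.antidiagonal n,
        D.coeff kl.1 * t ^ kl.1 * (t ^ kl.2 * q.coeff kl.2) = t ^ n • a n := by
      simp only [a, PowerSeries.coeff_mul, smul_eq_mul, Finset.mul_sum]
      refine Finset.sum_congr rfl fun kl hkl => ?_
      rw [← Finset.HasAntidiagonal.mem_antidiagonal.1 hkl, pow_add]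
      simp
      ring
    have hs := (summable_norm_sum_mul_antidiagonal_of_summable_norm hDn hqn).of_norm.hasSum
    rw [← tsum_mul_tsum_eq_tsum_sum_antidiagonal_of_summable_norm hDn hqn, hDsum.tsum_eq,
      hqsum.tsum_eq, hDt] at hs
    simpa [hterm] using hs
  have heq := hone.eq_formalMultilinearSeries hasFPowerSeriesAt_const
  ext n
  have hn : a n = (constFormalMultilinearSeries ℂ ℂ (1 : ℂ)).coeff n := by
    rw [← heq, FormalMultilinearSeries.coeff_ofScalars]
  refine hn.trans ?_
  rcases n with _ | n
  · simp [FormalMultilinearSeries.coeff]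
  · simp [FormalMultilinearSeries.coeff, PowerSeries.coeff_one]

lemma eval_charpolyRev_eq_det (A : Mat L) (t : ℂ) :
    A.charpolyRev.eval t = (1 - t • A).det := by
  rw [Matrix.charpolyRev, ← Polynomial.coe_evalRingHom, RingHom.map_det]
  congr 1
  ext i j
  rcases eq_or_ne i j with rfl | h
  · simp
    ring
  · simp [h]
    ring

lemma continuous_det_one_sub_smul : Continuous fun p : ℂ × Mat L => (1 - p.1 • p.2).det :=
  (continuous_const.sub (continuous_fst.smul continuous_snd)).matrix_det

/-- If `det (1 - t A)` has no zero in the disc of radius `r`, then `det (1 - t A) ^ (-L)` has the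
expected expansion there, and its coefficients satisfy Cauchy estimates. -/
lemma szegoPoly_expansion {A : Mat L} {r : NNReal} (hr : 0 < r)
    (hA : ∀ t : ℂ, ‖t‖ ≤ r → (1 - t • A).det ≠ 0) {M : ℝ}
    (hM : ∀ t : ℂ, ‖t‖ = r → ‖((1 - t • A).det ^ L)⁻¹‖ ≤ M) :
    (∀ t : ℂ, ‖t‖ < r → HasSum (fun k => t ^ k * eval (entries A) (szegoPoly L k))
      ((1 - t • A).det ^ L)⁻¹) ∧
    ∀ k, ‖eval (entries A) (szegoPoly L k)‖ ≤ M * (r : ℝ)⁻¹ ^ k := by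
  let h : ℂ → ℂ := fun t => ((A.charpolyRev ^ L).eval t)⁻¹
  have hne (t : ℂ) (ht : ‖t‖ ≤ r) : (A.charpolyRev ^ L).eval t ≠ 0 := by
    rw [Polynomial.eval_pow, eval_charpolyRev_eq_det]
    exact pow_ne_zero _ (hA t ht)
  have hh (t : ℂ) : h t = ((1 - t • A).det ^ L)⁻¹ := by
    simp only [h, Polynomial.eval_pow, eval_charpolyRev_eq_det]
  have hd : DiffContOnCl ℂ h (ball 0 (r : ℝ)) := by
    refine DifferentiableOn.diffContOnCl fun t ht => ?_
    rw [closure_ball _ (by exact_mod_cast hr.ne')] at ht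
    exact ((Polynomial.differentiable _ t).inv (hne t (by simpa using ht))).differentiableWithinAt
  have hps := hd.hasFPowerSeriesOnBall hr
  set q := cauchyPowerSeries h 0 (r : ℝ) with hq
  have hmk : ((A.charpolyRev ^ L : Polynomial ℂ) : PowerSeries ℂ) * PowerSeries.mk q.coeff = 1 := by
    refine mk_coeff_mul_eq_one hps.hasFPowerSeriesAt ?_
    filter_upwards [ball_mem_nhds (0 : ℂ) (show (0 : ℝ) < r from hr)] with t ht
    exact mul_inv_cancel₀ (hne t (le_of_lt (by simpa using ht)))
  rw [Polynomial.coe_pow] at hmk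
  have hcoef (k : ℕ) : q.coeff k = eval (entries A) (szegoPoly L k) := by
    simpa using (congrArg (PowerSeries.coeff k)
      (left_inv_eq_right_inv (mk_eval_szegoPoly_mul_charpolyRev A) hmk)).symm
  refine ⟨fun t ht => ?_, fun k => ?_⟩
  · have := hps.hasSum (y := t) (by simpa [← ofReal_norm, ENNReal.ofReal_lt_coe_iff] using ht)
    simpa only [FormalMultilinearSeries.apply_eq_pow_smul_coeff, hcoef, zero_add, hh, smul_eq_mul]
      using this
  · rw [← hcoef, ← FormalMultilinearSeries.norm_apply_eq_norm_coef]
    refine (norm_cauchyPowerSeries_le h 0 r k).trans ?_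
    rw [NNReal.abs_eq]
    gcongr
    have hint : ∫ θ : ℝ in 0..2 * Real.pi, ‖h (circleMap 0 r θ)‖ ≤
        ∫ _ in (0 : ℝ)..2 * Real.pi, M := by
      refine intervalIntegral.integral_mono_on (by positivity) ?_ (by simp) fun θ _ => ?_
      · refine (ContinuousOn.intervalIntegrable ?_)
        refine ContinuousOn.norm (hd.continuousOn.comp (continuous_circleMap 0 r).continuousOn
          fun θ _ => ?_)
        rw [closure_ball _ (by exact_mod_cast hr.ne')]
        simp
      · rw [hh]; exact hM _ (by simp)
    rw [intervalIntegral.integral_const, sub_zero, smul_eq_mul] at hint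
    calc _ ≤ (2 * Real.pi)⁻¹ * (2 * Real.pi * M) := by gcongr
      _ = M := by field_simp

end SzegoKernelExpansion

section SzegoIntegral

open MvPolynomial Metric

variable {L : ℕ}

lemma det_one_sub_smul_mul_conjTranspose_ne_zero {Y : Mat L} (hY : (1 - Yᴴ * Y).PosSemidef)
    {t : ℂ} (ht : ‖t‖ < 1) {U : Mat L} (hU : U ∈ Matrix.unitaryGroup (Fin L) ℂ) :
    (1 - t • (Y * Uᴴ)).det ≠ 0 := by
  rw [← Matrix.smul_mul]
  exact ((Matrix.isUnit_iff_isUnit_det _).1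
    (isUnit_one_sub_mul_conjTranspose (posDef_one_sub_smul hY ht) hU)).ne_zero

/-- A Cauchy estimate for the Szegő polynomials, uniform over the unitary group. -/
lemma exists_forall_norm_eval_szegoPoly_le {Y : Mat L} (hY : (1 - Yᴴ * Y).PosSemidef)
    {r : NNReal} (hr : 0 < r) (hr1 : r < 1) :
    ∃ M : ℝ, ∀ (U : Matrix.unitaryGroup (Fin L) ℂ) (k : ℕ),
      ‖eval (entries (Y * (U : Mat L)ᴴ)) (szegoPoly L k)‖ ≤ M * (r : ℝ)⁻¹ ^ k := by
  have hr1' : (r : ℝ) < 1 := hr1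
  have hne (U : Matrix.unitaryGroup (Fin L) ℂ) (t : ℂ) (ht : ‖t‖ ≤ r) :
      (1 - t • (Y * (U : Mat L)ᴴ)).det ≠ 0 :=
    det_one_sub_smul_mul_conjTranspose_ne_zero hY (ht.trans_lt hr1') U.2
  have hg : Continuous fun p : ℂ × Matrix.unitaryGroup (Fin L) ℂ =>
      (1 - p.1 • (Y * (p.2 : Mat L)ᴴ)).det :=
    continuous_det_one_sub_smul.comp (continuous_fst.prodMk
      (continuous_const.matrix_mul
        (continuous_subtype_val.comp continuous_snd).matrix_conjTranspose))
  obtain ⟨M, hM⟩ := ((isCompact_closedBall (0 : ℂ) r).prod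
    (isCompact_univ (X := Matrix.unitaryGroup (Fin L) ℂ))).exists_bound_of_continuousOn
    (f := fun p => ((1 - p.1 • (Y * (p.2 : Mat L)ᴴ)).det ^ L)⁻¹)
    ((hg.pow L).continuousOn.inv₀ fun p hp =>
      pow_ne_zero _ (hne p.2 p.1 (by simpa using hp.1)))
  exact ⟨M, fun U k => (szegoPoly_expansion hr (hne U)
    fun t ht => hM (t, U) ⟨by simp [ht], trivial⟩).2 k⟩

/-- The Szegő kernel integrates termwise against continuous functions on the unitary group. -/
lemma hasSum_integral_eval_szegoPoly_mul (μ : Measure (Matrix.unitaryGroup (Fin L) ℂ))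
    [IsFiniteMeasure μ] {g : Matrix.unitaryGroup (Fin L) ℂ → ℂ} (hg : Continuous g)
    {Y : Mat L} (hY : (1 - Yᴴ * Y).PosSemidef) {s : ℂ} (hs : ‖s‖ < 1) :
    HasSum (fun k => s ^ k * ∫ U : Matrix.unitaryGroup (Fin L) ℂ,
        eval (entries (Y * (U : Mat L)ᴴ)) (szegoPoly L k) * g U ∂μ)
      (∫ U : Matrix.unitaryGroup (Fin L) ℂ, ((1 - s • (Y * (U : Mat L)ᴴ)).det ^ L)⁻¹ * g U ∂μ) := by
  obtain ⟨r, hsr, hr1⟩ : ∃ r : NNReal, ‖s‖₊ < r ∧ r < 1 := exists_between hs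
  have hr : 0 < r := (zero_le (a := ‖s‖₊)).trans_lt hsr
  have hr1' : (r : ℝ) < 1 := hr1
  have hsr' : ‖s‖ < (r : ℝ) := hsr
  obtain ⟨M, hM⟩ := exists_forall_norm_eval_szegoPoly_le hY hr hr1
  obtain ⟨C, hC⟩ := isCompact_univ.exists_bound_of_continuousOn hg.continuousOn
  let F : ℕ → Matrix.unitaryGroup (Fin L) ℂ → ℂ := fun k U =>
    s ^ k * (eval (entries (Y * (U : Mat L)ᴴ)) (szegoPoly L k) * g U)
  have hFc (k : ℕ) : Continuous (F k) :=
    continuous_const.mul ((continuous_eval_entries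
      (continuous_const.matrix_mul continuous_subtype_val.matrix_conjTranspose) _).mul hg)
  have hFle (k : ℕ) (U : Matrix.unitaryGroup (Fin L) ℂ) :
      ‖F k U‖ ≤ M * C * (‖s‖ / r) ^ k := by
    calc ‖F k U‖ = ‖s‖ ^ k * (‖eval (entries (Y * (U : Mat L)ᴴ)) (szegoPoly L k)‖ * ‖g U‖) := by
          simp only [F, norm_mul, norm_pow]
      _ ≤ ‖s‖ ^ k * (M * (r : ℝ)⁻¹ ^ k * C) := by
          have := hM U k
          have := hC U trivial
          have := (norm_nonneg _).trans (hM U k)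
          gcongr
      _ = M * C * (‖s‖ / r) ^ k := by rw [div_eq_mul_inv, mul_pow]; ring
  have hgeom : Summable fun k => M * C * (‖s‖ / r) ^ k :=
    (summable_geometric_of_lt_one (by positivity)
      ((div_lt_one (by exact_mod_cast hr)).2 hsr')).mul_left _
  have hsum := hasSum_integral_of_dominated_convergence (μ := μ)
    (f := fun U => ((1 - s • (Y * (U : Mat L)ᴴ)).det ^ L)⁻¹ * g U)
    (fun k _ => M * C * (‖s‖ / r) ^ k)
    (fun k => (hFc k).aestronglyMeasurable)
    (fun k => Filter.Eventually.of_forall (hFle k))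
    (Filter.Eventually.of_forall fun _ => hgeom)
    (integrable_const _)
    (Filter.Eventually.of_forall fun U => by
      have hA (t : ℂ) (ht : ‖t‖ ≤ r) : (1 - t • (Y * (U : Mat L)ᴴ)).det ≠ 0 :=
        det_one_sub_smul_mul_conjTranspose_ne_zero hY (ht.trans_lt hr1') U.2
      have hdet : ContinuousOn (fun t : ℂ => ((1 - t • (Y * (U : Mat L)ᴴ)).det ^ L)⁻¹)
          (sphere 0 (r : ℝ)) :=
        ((continuous_det_one_sub_smul.comp
          (continuous_id.prodMk continuous_const)).pow L).continuousOn.inv₀ fun t ht =>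
            pow_ne_zero _ (hA t (by simpa using (mem_sphere_zero_iff_norm.1 ht).le))
      obtain ⟨N, hN⟩ := (isCompact_sphere (0 : ℂ) r).exists_bound_of_continuousOn hdet
      have := ((szegoPoly_expansion hr hA
        fun t ht => hN t (by simpa using ht)).1 s hsr').mul_right (g U)
      simpa only [F, mul_assoc] using this)
  simpa only [F, integral_const_mul] using hsum

end SzegoIntegral

theorem stmt16 (L : ℕ) (hL : 1 ≤ L) (f : Mat L → ℂ)
    (hcont : ContinuousOn (fun x : Fin L → Fin L → ℂ => f (Matrix.of x))
      {x : Fin L → Fin L → ℂ | ((1 : Mat L) - (Matrix.of x)ᴴ * Matrix.of x).PosSemidef})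
    (hanal : AnalyticOnNhd ℂ (fun x : Fin L → Fin L → ℂ => f (Matrix.of x))
      {x : Fin L → Fin L → ℂ | ((1 : Mat L) - (Matrix.of x)ᴴ * Matrix.of x).PosDef})
    (μ : Measure (Matrix.unitaryGroup (Fin L) ℂ))
    [μ.IsHaarMeasure] [IsProbabilityMeasure μ] :
    ∀ Z : Mat L, ((1 : Mat L) - Zᴴ * Z).PosDef →
      (∀ U : Matrix.unitaryGroup (Fin L) ℂ, IsUnit ((1 : Mat L) - Z * (U : Mat L)ᴴ)) ∧
      f Z = ∫ (U : Matrix.unitaryGroup (Fin L) ℂ),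
        (((1 : Mat L) - Z * (U : Mat L)ᴴ).det) ^ (-(L : ℤ)) * f (U : Mat L) ∂μ := by
  intro Z hZ
  refine ⟨fun U => isUnit_one_sub_mul_conjTranspose hZ U.2, ?_⟩
  obtain ⟨s, Y, hs, hY, rfl⟩ := exists_smul_eq_of_posDef hL hZ
  obtain ⟨P, hP, hPf⟩ := exists_taylor_polynomials hcont hanal
  have hf : ContinuousOn f (Matrix.unitaryGroup (Fin L) ℂ) :=
    ContinuousOn.mono (t := _) hcont fun U hU => posSemidef_one_sub_of_mem_unitaryGroup hU
  have hfc : Continuous fun U : Matrix.unitaryGroup (Fin L) ℂ => f (U : Mat L) :=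
    continuousOn_iff_continuous_domRestrict.1 hf
  have hsum := hasSum_integral_eval_szegoPoly_mul μ hfc hY hs
  simp only [integral_eval_szegoPoly_mul μ hf (hP _) fun U hU =>
    (hPf U (posSemidef_one_sub_of_mem_unitaryGroup hU)).2 _] at hsum
  rw [((hPf Y hY).1 s hs).unique hsum]
  simp only [Matrix.smul_mul, _root_.zpow_neg, _root_.zpow_natCast]
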